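/- Let Z be a real vector space with a quasi-norm ‖·‖_Z of quasi-triangle constant κ, let m, n, m₀, m₁, n₀, n₁ ≥ 1, and let τ : ℝ^m × ℝ^n → Z be a bilinear map such that for some real matrices A₀ (of size m₀×m), A₁ (of size m₁×m), B₀ (of size n₀×n), B₁ (of size n₁×n) one has ‖τ(x,y)‖_Z ≤ |A₀x|·|B₀y| + |A₁x|·|B₁y| for all x ∈ ℝ^m and y ∈ ℝ^n, where |·| denotes Euclidean norms. Then there exist bilinear maps τ₀, τ₁ : ℝ^m × ℝ^n → Z and a constant C depending only on m, n, κ such that τ(x,y) = τ₀(x,y) + τ₁(x,y) for all x, y, and ‖τ_k(x,y)‖_Z ≤ C·|A_k x|·|B_k y| for all x, y and k = 0, 1. -/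

import Mathlib

open scoped TensorProduct

universe u v

/-- The Euclidean norm on `Fin k → ℝ`. -/
noncomputable def euclNorm {k : ℕ} (x : Fin k → ℝ) : ℝ := Real.sqrt (∑ i, x i ^ 2)

/-- The operator norm of an `n × n` real matrix with respect to the Euclidean norm. -/
noncomputable def opNorm {n : ℕ} (M : Matrix (Fin n) (Fin n) ℝ) : ℝ :=
  ‖Matrix.toEuclideanCLM (𝕜 := ℝ) M‖

/-- A quasi-norm on a real vector space `Z` with quasi-triangle constant `κ`. -/
def IsQuasiNorm {Z : Type*} [AddCommGroup Z] [Module ℝ Z] (N : Z → ℝ) (κ : ℝ) : Prop :=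
  (∀ z, 0 ≤ N z) ∧ (∀ (l : ℝ) (z : Z), N (l • z) = |l| * N z) ∧
    ∀ z w, N (z + w) ≤ κ * (N z + N w)

/-- `A` is a reducing matrix for the tuple `f` with respect to `N` (with constants
`c₁ ≤ c₂`): `A` is positive semidefinite and `c₁|Ae| ≤ N(∑ eᵢ • fᵢ) ≤ c₂|Ae|`. -/
def IsReducing {X : Type*} [AddCommGroup X] [Module ℝ X] (N : X → ℝ)
    {n : ℕ} (f : Fin n → X) (c₁ c₂ : ℝ) (A : Matrix (Fin n) (Fin n) ℝ) : Prop :=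
  A.PosSemidef ∧ ∀ e : Fin n → ℝ,
    c₁ * euclNorm (A.mulVec e) ≤ N (∑ i, e i • f i) ∧
      N (∑ i, e i • f i) ≤ c₂ * euclNorm (A.mulVec e)

open scoped TensorProduct

lemma cs_key {H : Type*} [NormedAddCommGroup H] [InnerProductSpace ℝ H] (u v : H) (l t : ℝ)
    (h1 : inner ℝ u v = l * t) (h2 : inner ℝ u u = l) : |t| * ‖u‖ ≤ ‖v‖ := by
  by_cases hu : ‖u‖ = 0
  · rw [hu, mul_zero]; exact norm_nonneg _
  have hu' : 0 < ‖u‖ := lt_of_le_of_ne (norm_nonneg _) (Ne.symm hu)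
  have h3 := abs_real_inner_le_norm u v
  rw [h1, ← h2, real_inner_self_eq_norm_sq, abs_mul, abs_of_nonneg (sq_nonneg _)] at h3
  nlinarith

lemma symm_key {R E : Type*} [NormedAddCommGroup R] [InnerProductSpace ℝ R]
    [FiniteDimensional ℝ R] [NormedAddCommGroup E] [InnerProductSpace ℝ E]
    [FiniteDimensional ℝ E] (G : R →ₗ[ℝ] E) : (LinearMap.adjoint G ∘ₗ G).IsSymmetric := by
  intro x y
  simp [LinearMap.adjoint_inner_left, LinearMap.adjoint_inner_right]

lemma diag_abs {V E F : Type*} [AddCommGroup V] [Module ℝ V] [FiniteDimensional ℝ V]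
    [NormedAddCommGroup E] [InnerProductSpace ℝ E] [FiniteDimensional ℝ E]
    [NormedAddCommGroup F] [InnerProductSpace ℝ F] [FiniteDimensional ℝ F]
    (f : V →ₗ[ℝ] E) (g : V →ₗ[ℝ] F) :
    ∃ (d : ℕ) (e : Fin d → V) (φ : Fin d → V →ₗ[ℝ] ℝ), d ≤ Module.finrank ℝ V ∧
      (∀ x i, |φ i x| * ‖f (e i)‖ ≤ ‖f x‖) ∧ (∀ x i, |φ i x| * ‖g (e i)‖ ≤ ‖g x‖) ∧
      (∀ x, f (x - ∑ i, φ i x • e i) = 0) ∧ (∀ x, g (x - ∑ i, φ i x • e i) = 0) := by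
  let L : V →ₗ[ℝ] WithLp 2 (E × F) := (WithLp.linearEquiv 2 ℝ (E × F)).symm.toLinearMap ∘ₗ f.prod g
  have hL : ∀ x, L x = WithLp.toLp 2 (f x, g x) := fun x => rfl
  let G : LinearMap.range L →ₗ[ℝ] E :=
    (LinearMap.fst ℝ E F ∘ₗ (WithLp.linearEquiv 2 ℝ (E × F)).toLinearMap) ∘ₗ
      (LinearMap.range L).subtype
  let T : LinearMap.range L →ₗ[ℝ] LinearMap.range L := LinearMap.adjoint G ∘ₗ G
  have hT : T.IsSymmetric := symm_key G
  let b := hT.eigenvectorBasis rfl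
  have hb : ∀ i, ∃ e, L e = (b i : WithLp 2 (E × F)) := fun i => (b i).2
  choose e he using hb
  have he' : ∀ i, b i = L.rangeRestrict (e i) := fun i => Subtype.ext (he i).symm
  let φ : Fin (Module.finrank ℝ (LinearMap.range L)) → V →ₗ[ℝ] ℝ :=
    fun i => (innerₛₗ ℝ (b i)) ∘ₗ L.rangeRestrict
  have hφ : ∀ i x, φ i x = inner ℝ (f (e i)) (f x) + inner ℝ (g (e i)) (g x) := by
    intro i x
    change inner ℝ (b i) (L.rangeRestrict x) = _
    rw [he' i]
    change inner ℝ (L (e i)) (L x) = _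
    rw [hL, hL, WithLp.prod_inner_apply]
  have h0 : ∀ i, ∃ l : ℝ, ∀ x, inner ℝ (f (e i)) (f x) = l * φ i x := by
    intro i
    refine ⟨hT.eigenvalues rfl i, fun x => ?_⟩
    have h1 : inner ℝ (T (b i)) (L.rangeRestrict x) = inner ℝ (f (e i)) (f x) := by
      change inner ℝ (LinearMap.adjoint G (G (b i))) _ = _
      rw [LinearMap.adjoint_inner_left, he' i]
      rfl
    rw [← h1, hT.apply_eigenvectorBasis rfl i, inner_smul_left]
    rfl
  have hone : ∀ i, φ i (e i) = 1 := by
    intro i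
    change inner ℝ (b i) (L.rangeRestrict (e i)) = 1
    rw [← he' i, real_inner_self_eq_norm_sq, b.orthonormal.1 i]; norm_num
  have hz : ∀ x, L (x - ∑ i, φ i x • e i) = 0 := by
    intro x
    have h := congrArg Subtype.val (b.sum_repr' (L.rangeRestrict x))
    rw [map_sub, map_sum, sub_eq_zero]
    simp only [map_smul, he]
    rw [Submodule.coe_sum] at h
    exact h.symm
  refine ⟨_, e, φ, LinearMap.finrank_range_le L, ?_, ?_, ?_, ?_⟩
  · intro x i
    obtain ⟨l, hl⟩ := h0 i
    exact cs_key _ _ l _ (hl x) (by rw [hl, hone, mul_one])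
  · intro x i
    obtain ⟨l, hl⟩ := h0 i
    have h1 : ∀ x, inner ℝ (g (e i)) (g x) = (1 - l) * φ i x := by
      intro x
      linarith [hφ i x, hl x]
    exact cs_key _ _ (1 - l) _ (h1 x) (by rw [h1, hone, mul_one])
  · intro x
    exact congrArg (fun z => (WithLp.ofLp z).1) (hz x)
  · intro x
    exact congrArg (fun z => (WithLp.ofLp z).2) (hz x)

lemma euclNorm_eq {k : ℕ} (x : Fin k → ℝ) : euclNorm x = ‖WithLp.toLp 2 x‖ := by
  simp [euclNorm, EuclideanSpace.norm_eq]

lemma euclNorm_nonneg {k : ℕ} (x : Fin k → ℝ) : 0 ≤ euclNorm x := Real.sqrt_nonneg _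

lemma euclNorm_zero {k : ℕ} : euclNorm (0 : Fin k → ℝ) = 0 := by simp [euclNorm]

lemma diag_mat {m a b : ℕ} (A : Matrix (Fin a) (Fin m) ℝ) (B : Matrix (Fin b) (Fin m) ℝ) :
    ∃ (d : ℕ) (e : Fin d → (Fin m → ℝ)) (φ : Fin d → (Fin m → ℝ) →ₗ[ℝ] ℝ), d ≤ m ∧
      (∀ x i, |φ i x| * euclNorm (A.mulVec (e i)) ≤ euclNorm (A.mulVec x)) ∧
      (∀ x i, |φ i x| * euclNorm (B.mulVec (e i)) ≤ euclNorm (B.mulVec x)) ∧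
      (∀ x, euclNorm (A.mulVec (x - ∑ i, φ i x • e i)) = 0) ∧
      (∀ x, euclNorm (B.mulVec (x - ∑ i, φ i x • e i)) = 0) := by
  obtain ⟨d, e, φ, h0, h1, h2, h3, h4⟩ := diag_abs
    ((WithLp.linearEquiv 2 ℝ (Fin a → ℝ)).symm.toLinearMap ∘ₗ A.mulVecLin)
    ((WithLp.linearEquiv 2 ℝ (Fin b → ℝ)).symm.toLinearMap ∘ₗ B.mulVecLin)
  refine ⟨d, e, φ, by simpa using h0, ?_, ?_, ?_, ?_⟩
  · intro x i; rw [euclNorm_eq, euclNorm_eq]; exact h1 x i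
  · intro x i; rw [euclNorm_eq, euclNorm_eq]; exact h2 x i
  · intro x; rw [euclNorm_eq, norm_eq_zero]; exact h3 x
  · intro x; rw [euclNorm_eq, norm_eq_zero]; exact h4 x

lemma quasi_sum {Z : Type*} [AddCommGroup Z] [Module ℝ Z] {N : Z → ℝ} {κ : ℝ} (hκ : 1 ≤ κ)
    (hN : IsQuasiNorm N κ) {ι : Type*} (s : Finset ι) (f : ι → Z) (M : ℝ) (hM : 0 ≤ M)
    (hf : ∀ i ∈ s, N (f i) ≤ M) : N (∑ i ∈ s, f i) ≤ κ ^ s.card * (s.card * M) := by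
  classical
  induction s using Finset.induction_on with
  | empty =>
    have := hN.2.1 0 0
    simp at this
    simp [this]
  | insert a s ha ih =>
    rw [Finset.sum_insert ha, Finset.card_insert_of_notMem ha]
    have h1 := ih (fun i hi => hf i (Finset.mem_insert_of_mem hi))
    have h2 := hf a (Finset.mem_insert_self a s)
    have hp : 1 ≤ κ ^ s.card := one_le_pow₀ hκ
    have h3 : M ≤ κ ^ s.card * M := le_mul_of_one_le_left hM hp
    calc N (f a + ∑ i ∈ s, f i) ≤ κ * (N (f a) + N (∑ i ∈ s, f i)) := hN.2.2 _ _
      _ ≤ κ * (κ ^ s.card * M + κ ^ s.card * (s.card * M)) := by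
        gcongr
        linarith
      _ = _ := by push_cast; ring

lemma quasi_sum' {Z : Type*} [AddCommGroup Z] [Module ℝ Z] {N : Z → ℝ} {κ : ℝ} (hκ : 1 ≤ κ)
    (hN : IsQuasiNorm N κ) {ι : Type*} (s : Finset ι) (f : ι → Z) (M : ℝ) (hM : 0 ≤ M)
    (hf : ∀ i ∈ s, N (f i) ≤ M) (c : ℕ) (hc : s.card ≤ c) :
    N (∑ i ∈ s, f i) ≤ κ ^ c * (c * M) := by
  refine (quasi_sum hκ hN s f M hM hf).trans ?_
  gcongr

/-- **Splitting of a bilinear map with a two-term bound** (Lemma 5.1, general case):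
if `‖τ(x,y)‖_Z ≤ |A₀x||B₀y| + |A₁x||B₁y|`, then `τ = τ₀ + τ₁` with
`‖τₖ(x,y)‖_Z ≲ |Aₖx||Bₖy|`, the implicit constant depending only on `m, n, κ`. -/
theorem stmt15 (m n : ℕ) (hm : 1 ≤ m) (hn : 1 ≤ n) (κ : ℝ) (hκ : 1 ≤ κ) :
    ∃ C : ℝ, 0 < C ∧
      ∀ (Z : Type u) [AddCommGroup Z] [Module ℝ Z] (NZ : Z → ℝ), IsQuasiNorm NZ κ →
      ∀ (m₀ m₁ n₀ n₁ : ℕ), 1 ≤ m₀ → 1 ≤ m₁ → 1 ≤ n₀ → 1 ≤ n₁ →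
      ∀ (A₀ : Matrix (Fin m₀) (Fin m) ℝ) (A₁ : Matrix (Fin m₁) (Fin m) ℝ)
        (B₀ : Matrix (Fin n₀) (Fin n) ℝ) (B₁ : Matrix (Fin n₁) (Fin n) ℝ)
        (τ : (Fin m → ℝ) →ₗ[ℝ] (Fin n → ℝ) →ₗ[ℝ] Z),
        (∀ (x : Fin m → ℝ) (y : Fin n → ℝ),
          NZ (τ x y) ≤ euclNorm (A₀.mulVec x) * euclNorm (B₀.mulVec y)
            + euclNorm (A₁.mulVec x) * euclNorm (B₁.mulVec y)) →
        ∃ τ₀ τ₁ : (Fin m → ℝ) →ₗ[ℝ] (Fin n → ℝ) →ₗ[ℝ] Z,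
          (∀ (x : Fin m → ℝ) (y : Fin n → ℝ), τ x y = τ₀ x y + τ₁ x y) ∧
          (∀ (x : Fin m → ℝ) (y : Fin n → ℝ),
            NZ (τ₀ x y) ≤ C * (euclNorm (A₀.mulVec x) * euclNorm (B₀.mulVec y))) ∧
          (∀ (x : Fin m → ℝ) (y : Fin n → ℝ),
            NZ (τ₁ x y) ≤ C * (euclNorm (A₁.mulVec x) * euclNorm (B₁.mulVec y))) := by
  classical
  refine ⟨κ ^ 2 * (κ ^ (m * n) * ((m * n : ℕ) * 2)), by positivity, ?_⟩
  intro Z _ _ N hN m₀ m₁ n₀ n₁ _ _ _ _ A₀ A₁ B₀ B₁ τ hτ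
  obtain ⟨d, e, φ, hd, he0, he1, hr0, hr1⟩ := diag_mat A₀ A₁
  obtain ⟨d', e', ψ, hd', he0', he1', hr0', hr1'⟩ := diag_mat B₀ B₁
  let S : Finset (Fin d × Fin d') := Finset.univ.filter fun p =>
    euclNorm (A₁.mulVec (e p.1)) * euclNorm (B₁.mulVec (e' p.2)) ≤
      euclNorm (A₀.mulVec (e p.1)) * euclNorm (B₀.mulVec (e' p.2))
  let σ : Finset (Fin d × Fin d') → (Fin m → ℝ) →ₗ[ℝ] (Fin n → ℝ) →ₗ[ℝ] Z := fun s =>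
    ∑ p ∈ s, (φ p.1).smulRight ((ψ p.2).smulRight (τ (e p.1) (e' p.2)))
  have hσ : ∀ s x y, σ s x y = ∑ p ∈ s, φ p.1 x • ψ p.2 y • τ (e p.1) (e' p.2) := by
    intro s x y
    simp [σ, LinearMap.sum_apply]
  have hcard : ∀ s : Finset (Fin d × Fin d'), s.card ≤ m * n := by
    intro s
    refine (Finset.card_le_univ s).trans ?_
    simp only [Fintype.card_prod, Fintype.card_fin]
    exact Nat.mul_le_mul hd hd'
  have term : ∀ (s t a b a' b' X Y : ℝ), 0 ≤ a → 0 ≤ b → 0 ≤ X → |s| * a ≤ X → |t| * b ≤ Y →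
      a' * b' ≤ a * b → |s| * (|t| * (a * b + a' * b')) ≤ 2 * (X * Y) := by
    intro s t a b a' b' X Y ha hb hX h1 h2 h3
    calc |s| * (|t| * (a * b + a' * b')) ≤ |s| * (|t| * (a * b + a * b)) := by gcongr
      _ = 2 * ((|s| * a) * (|t| * b)) := by ring
      _ ≤ 2 * (X * Y) := by gcongr
  have hκ0 : 0 ≤ κ := by linarith
  have b0 : ∀ x y, N (σ S x y) ≤ κ ^ (m * n) * ((m * n : ℕ) *
      (2 * (euclNorm (A₀.mulVec x) * euclNorm (B₀.mulVec y)))) := by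
    intro x y
    rw [hσ]
    refine quasi_sum' hκ hN S _ _ ?_ ?_ _ (hcard S)
    · have := euclNorm_nonneg (A₀.mulVec x)
      have := euclNorm_nonneg (B₀.mulVec y)
      positivity
    · intro p hp
      rw [hN.2.1, hN.2.1]
      refine le_trans ?_ (term (φ p.1 x) (ψ p.2 y) _ _ _ _ _ _ (euclNorm_nonneg _)
        (euclNorm_nonneg _) (euclNorm_nonneg _) (he0 x p.1) (he0' y p.2)
        (Finset.mem_filter.1 hp).2)
      gcongr
      exact hτ _ _
  have b1 : ∀ x y, N (σ Sᶜ x y) ≤ κ ^ (m * n) * ((m * n : ℕ) *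
      (2 * (euclNorm (A₁.mulVec x) * euclNorm (B₁.mulVec y)))) := by
    intro x y
    rw [hσ]
    refine quasi_sum' hκ hN Sᶜ _ _ ?_ ?_ _ (hcard Sᶜ)
    · have := euclNorm_nonneg (A₁.mulVec x)
      have := euclNorm_nonneg (B₁.mulVec y)
      positivity
    · intro p hp
      rw [hN.2.1, hN.2.1]
      have hp' : ¬ (euclNorm (A₁.mulVec (e p.1)) * euclNorm (B₁.mulVec (e' p.2)) ≤
          euclNorm (A₀.mulVec (e p.1)) * euclNorm (B₀.mulVec (e' p.2))) := by
        simpa [S] using hp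
      refine le_trans ?_ (term (φ p.1 x) (ψ p.2 y) _ _ _ _ _ _ (euclNorm_nonneg _)
        (euclNorm_nonneg _) (euclNorm_nonneg _) (he1 x p.1) (he1' y p.2)
        (not_le.1 hp').le)
      gcongr
      rw [add_comm]
      exact hτ _ _
  have hsplit : ∀ x y, σ S x y + σ Sᶜ x y = τ (∑ i, φ i x • e i) (∑ j, ψ j y • e' j) := by
    intro x y
    rw [hσ, hσ, Finset.sum_add_sum_compl, Fintype.sum_prod_type]
    simp [map_sum, LinearMap.sum_apply, Finset.smul_sum]
    rw [Finset.sum_comm]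
    exact Finset.sum_congr rfl fun i _ => Finset.sum_congr rfl fun j _ => smul_comm _ _ _
  refine ⟨τ - σ Sᶜ, σ Sᶜ, fun x y => by simp, ?_, ?_⟩
  · intro x y
    set u := ∑ i, φ i x • e i with hu
    set v := ∑ j, ψ j y • e' j with hv
    have z1 : N (τ (x - u) y) ≤ 0 := by
      refine (hτ _ _).trans ?_
      rw [hr0 x, hr1 x]; simp
    have z2 : N (τ u (y - v)) ≤ 0 := by
      refine (hτ _ _).trans ?_
      rw [hr0' y, hr1' y]; simp
    have heq : (τ - σ Sᶜ) x y = τ (x - u) y + (τ u (y - v) + σ S x y) := by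
      have := hsplit x y
      rw [← hu, ← hv] at this
      rw [eq_sub_of_add_eq this]
      simp
    rw [heq]
    have w1 := hN.2.2 (τ (x - u) y) (τ u (y - v) + σ S x y)
    have w2 := hN.2.2 (τ u (y - v)) (σ S x y)
    calc _ ≤ κ * (N (τ (x - u) y) + N (τ u (y - v) + σ S x y)) := w1
      _ ≤ κ * (0 + κ * (0 + κ ^ (m * n) * ((m * n : ℕ) *
          (2 * (euclNorm (A₀.mulVec x) * euclNorm (B₀.mulVec y)))))) := by
        gcongr
        refine w2.trans ?_
        gcongr
        exact b0 x y
      _ = _ := by ring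
  · intro x y
    have h1 : 1 ≤ κ ^ 2 := one_le_pow₀ hκ
    have := euclNorm_nonneg (A₁.mulVec x)
    have := euclNorm_nonneg (B₁.mulVec y)
    refine (b1 x y).trans ?_
    calc _ ≤ κ ^ 2 * (κ ^ (m * n) * ((m * n : ℕ) *
          (2 * (euclNorm (A₁.mulVec x) * euclNorm (B₁.mulVec y))))) :=
        le_mul_of_one_le_left (by positivity) h1
      _ = _ := by ring
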